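/- arXiv:1010.5397 — 3 statements merged into one kernel-verified Lean document; each statement's English description precedes it below -/
import Mathlib

section
/- Let E be a framed Ĥ_n-invariant representation of A_{n-1}^{⊗n} supported over vertices with indices 0,…,n-1, and fix vertices a_0,…,a_{n-1} of A_{n-1}^{⊗n} with λ(a_i) = i for 0 ≤ i ≤ n-1. Define a representation E' of A_{n-1}^{⊗n} by E'_b := E_{a_{λ(b)}} for vertices b with λ(b) ≤ n-1 (and E'_b := 0 otherwise), and, for each arrow b → b' with λ(b) = i ≤ n-2, E'_{b,b'} := φ_{b',a_{i+1}} ∘ E_{b,b'} ∘ φ_{a_i,b}. Then: (i) E' is a well-defined representation of A_{n-1}^{⊗n}, i.e. E'_{b,b'} depends only on i and λ(b,b') and the commuting relations hold for E'; (ii) E' is framed Ĥ_n-invariant with all framing isomorphisms equal to the identity; (iii) the family t^E with t^E_a := φ_{a,a_{λ(a)}} : E_a → E'_a is an isomorphism of representations E → E' (i.e. t^E_{b'} ∘ E_{b,b'} = E'_{b,b'} ∘ t^E_b for every arrow b → b' and each t^E_a is invertible), and t^E is a framed Ĥ_n-invariant morphism. -/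
/-!
Statement 0.  Setting: the quiver `A_{n-1}^{⊗ n}`.
Vertices are functions `a : Fin n → Fin n` (the `n` coordinates, each taking the
values `0, …, n-1`), the index of a vertex is `lam a = ∑ i, a i`, and there is an
arrow `a → b` with label `j` iff `b` increases the `j`-th coordinate of `a` by one
and agrees with `a` elsewhere.  Possibly degenerate arrows are encoded with labels
in `Option (Fin n)`: the label `none` stands for the degenerate arrow `a → a`
(the label `λ(a,a) = 0` of the paper).
-/

/-- Vertices of the quiver `A_{n-1}^{⊗ n}`. -/
abbrev Vtx (n : ℕ) := Fin n → Fin n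

/-- The index `λ(a) = ∑ i, a i` of a vertex. -/
def lam {n : ℕ} (a : Vtx n) : ℕ := ∑ i, (a i : ℕ)

/-- `IsArrow a b j`: there is a (non-degenerate) arrow `a → b` with label
`λ(a,b) = j`. -/
def IsArrow {n : ℕ} (a b : Vtx n) (j : Fin n) : Prop :=
  ((b j : ℕ) = (a j : ℕ) + 1) ∧ ∀ i, i ≠ j → b i = a i

/-- Possibly degenerate arrows, with the degenerate arrow `a → a` labelled by
`none`. -/
def HasArrow {n : ℕ} (a b : Vtx n) : Option (Fin n) → Prop
  | none => a = b
  | some j => IsArrow a b j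

/-- The index of the target of an arrow is one more than that of the source. -/
lemma lam_arrow {n : ℕ} {a b : Vtx n} {j : Fin n} (h : IsArrow a b j) :
    lam b = lam a + 1 := by
  unfold lam
  rw [← Finset.add_sum_erase Finset.univ (fun i => (b i : ℕ)) (Finset.mem_univ j),
      ← Finset.add_sum_erase Finset.univ (fun i => (a i : ℕ)) (Finset.mem_univ j)]
  have h2 : ∑ i ∈ Finset.univ.erase j, (b i : ℕ) =
      ∑ i ∈ Finset.univ.erase j, (a i : ℕ) :=
    Finset.sum_congr rfl fun i hi => by rw [h.2 i (Finset.ne_of_mem_erase hi)]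
  have h1 := h.1
  omega

/-- Transport of a linear map along equalities of vertices. -/
def lcast {n : ℕ} {V : Vtx n → Type} [∀ v, AddCommGroup (V v)] [∀ v, Module ℂ (V v)]
    {x x' y y' : Vtx n} (hx : x = x') (hy : y = y') (g : V x →ₗ[ℂ] V y) :
    V x' →ₗ[ℂ] V y' := by subst hx; subst hy; exact g

/-- `gVert a b` is the chosen vertex `a (λ b)` of index `λ b` when `λ b ≤ n - 1`,
and `b` itself otherwise (where, for a supported representation, the vertex
space is the zero space anyway).  The vertex spaces of the representation `E'`
of Lemma `lem:triv` are `E'_b = E_{gVert a b}`. -/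
def gVert {n : ℕ} (a : Fin n → Vtx n) (b : Vtx n) : Vtx n :=
  if h : lam b < n then a ⟨lam b, h⟩ else b
open Classical in
/-- The arrow maps of the representation `E'` of Lemma `lem:triv`:
for an arrow `b → b'` with `λ(b) = i ≤ n-2`,
`E'_{b,b'} := φ_{b', a_{i+1}} ∘ E_{b,b'} ∘ φ_{a_i, b}`; the identity on the
degenerate arrows; and the zero map otherwise. -/
noncomputable def primedMap {n : ℕ} (V : Vtx n → Type)
    [∀ v, AddCommGroup (V v)] [∀ v, Module ℂ (V v)]
    (E : ∀ u v : Vtx n, V u →ₗ[ℂ] V v) (φ : ∀ u v : Vtx n, V u →ₗ[ℂ] V v)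
    (a : Fin n → Vtx n) (b b' : Vtx n) :
    V (gVert a b) →ₗ[ℂ] V (gVert a b') :=
  if hbb : b = b' then lcast rfl (congrArg (gVert a) hbb) LinearMap.id
  else if h : (lam b + 1 < n) ∧ ∃ j : Fin n, IsArrow b b' j then
    have h1 : lam b < n := Nat.lt_of_succ_lt h.1
    have hb' : lam b' = lam b + 1 := lam_arrow h.2.choose_spec
    have e1 : gVert a b = a ⟨lam b, h1⟩ := dif_pos h1
    have e2 : gVert a b' = a ⟨lam b + 1, h.1⟩ := by
      unfold gVert
      rw [dif_pos (show lam b' < n by omega),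
        show (⟨lam b', by omega⟩ : Fin n) = ⟨lam b + 1, h.1⟩ from Fin.mk_eq_mk.mpr hb']
    lcast e1.symm e2.symm
      (((φ b' (a ⟨lam b + 1, h.1⟩)).comp (E b b')).comp (φ (a ⟨lam b, h1⟩) b))
  else 0

/-- The framing isomorphisms of `E'`: the identity (transport along the equality
of vertices) wherever the chosen vertices agree, and the zero map between the
remaining (zero) spaces. -/
noncomputable def primedFraming {n : ℕ} (V : Vtx n → Type)
    [∀ v, AddCommGroup (V v)] [∀ v, Module ℂ (V v)]
    (a : Fin n → Vtx n) (b c : Vtx n) :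
    V (gVert a b) →ₗ[ℂ] V (gVert a c) :=
  if h : gVert a b = gVert a c then lcast rfl h LinearMap.id else 0
theorem lam_gVert {n : ℕ} (a : Fin n → Vtx n) (ha : ∀ i : Fin n, lam (a i) = (i : ℕ))
    (b : Vtx n) : lam (gVert a b) = lam b := by
  unfold gVert
  split_ifs with h
  · rw [ha]
  · rfl

theorem lam_hasArrow {n : ℕ} {p q r s : Vtx n} {j : Option (Fin n)} (h : HasArrow p q j)
    (h' : HasArrow r s j) (e : lam p = lam r) : lam q = lam s := by
  cases j with
  | none => cases h; cases h'; exact e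
  | some j => rw [lam_arrow h, lam_arrow h', e]

theorem lcast_eq {n : ℕ} {V : Vtx n → Type} [∀ v, AddCommGroup (V v)] [∀ v, Module ℂ (V v)]
    (φ : ∀ a b : Vtx n, V a →ₗ[ℂ] V b) (hid : ∀ a, φ a a = LinearMap.id)
    {x x' y y' : Vtx n} (hx : x = x') (hy : y = y') (g : V x →ₗ[ℂ] V y) :
    lcast hx hy g = ((φ y y').comp g).comp (φ x' x) := by
  subst hx; subst hy
  rw [hid, hid]
  rfl

/-- Lemma `lem:triv`.  Let `E` (vertex spaces `V`, arrow maps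
`E`, framing isomorphisms `φ`) be a framed `Ĥₙ`-invariant representation of
`A_{n-1}^{⊗ n}` supported over vertices with indices `0, …, n-1`, and fix
vertices `a i` with `λ(a i) = i`.  Let `E' := primedMap V E φ a` (with vertex
spaces `E'_b = V (gVert a b)`, i.e. `E'_b = E_{a_{λ(b)}}` for `λ(b) ≤ n-1` and
the zero space otherwise) and let `ψ := primedFraming V a` be the identity
framings.  Then:
(i)   `E'` is a representation of `A_{n-1}^{⊗ n}` (identities on degenerate
      arrows, and the commuting relations hold), its arrow map on an arrow
      `b → b'` with `λ(b) ≤ n-2` depends only on `λ(b)` and the label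
      `λ(b,b')`, and `E'` is supported over indices `0, …, n-1`;
(ii)  `ψ` consists of identities, its maps are bijective whenever the indices
      agree, and it makes `E'` framed `Ĥₙ`-invariant;
(iii) `t b := φ_{b, gVert a b}` (that is, `t b = φ_{b, a_{λ(b)}}` on the support)
      is an isomorphism of representations `E → E'` and is a framed
      `Ĥₙ`-invariant morphism. -/
theorem stmt2 (n : ℕ) (hn : 2 ≤ n)
    (V : Vtx n → Type) [∀ a, AddCommGroup (V a)] [∀ a, Module ℂ (V a)]
    [∀ a, FiniteDimensional ℂ (V a)]
    (E : ∀ a b : Vtx n, V a →ₗ[ℂ] V b)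
    (hEid : ∀ a : Vtx n, E a a = LinearMap.id)
    (hEcomm : ∀ (p q r s : Vtx n) (j j' : Option (Fin n)),
      HasArrow p q j → HasArrow r s j → HasArrow p r j' → HasArrow q s j' →
      (E q s).comp (E p q) = (E r s).comp (E p r))
    (φ : ∀ a b : Vtx n, V a →ₗ[ℂ] V b)
    (hφbij : ∀ a b : Vtx n, lam a = lam b → Function.Bijective (φ a b))
    (hφ : ∀ (a a' b c c' : Vtx n) (j : Option (Fin n)),
      HasArrow a a' j → HasArrow c c' j → lam a = lam b → lam b = lam c →
      (φ a' c').comp (E a a') = ((E c c').comp (φ b c)).comp (φ a b))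
    -- `E` is supported over vertices with indices `0, …, n-1`:
    (hsupp : ∀ b : Vtx n, n ≤ lam b → ∀ v : V b, v = 0)
    -- the fixed vertices `a_0, …, a_{n-1}`:
    (a : Fin n → Vtx n) (ha : ∀ i : Fin n, lam (a i) = (i : ℕ)) :
    -- (i) `E'` is a well-defined representation of `A_{n-1}^{⊗ n}`:
    (∀ b : Vtx n, primedMap V E φ a b b = LinearMap.id) ∧
    (∀ (p q r s : Vtx n) (j j' : Option (Fin n)),
      HasArrow p q j → HasArrow r s j → HasArrow p r j' → HasArrow q s j' →
      (primedMap V E φ a q s).comp (primedMap V E φ a p q) =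
        (primedMap V E φ a r s).comp (primedMap V E φ a p r)) ∧
    -- `E'_{b,b'}` depends only on `i = λ(b)` and the label `λ(b,b')`:
    (∀ (p q r s : Vtx n) (j : Fin n), IsArrow p q j → IsArrow r s j →
      lam p = lam r → lam p + 1 < n →
      ∀ (h1 : gVert a p = gVert a r) (h2 : gVert a q = gVert a s),
        primedMap V E φ a r s = lcast h1 h2 (primedMap V E φ a p q)) ∧
    -- `E'` is supported over vertices with indices `0, …, n-1`:
    (∀ b : Vtx n, n ≤ lam b → ∀ v : V (gVert a b), v = 0) ∧
    -- (ii) `E'` is framed `Ĥₙ`-invariant with the identity framings `ψ`: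
    (∀ b c : Vtx n, ∀ h : gVert a b = gVert a c,
      primedFraming V a b c = lcast rfl h LinearMap.id) ∧
    (∀ b c : Vtx n, lam b = lam c → Function.Bijective (primedFraming V a b c)) ∧
    (∀ (p p' q r r' : Vtx n) (j : Option (Fin n)),
      HasArrow p p' j → HasArrow r r' j → lam p = lam q → lam q = lam r →
      (primedFraming V a p' r').comp (primedMap V E φ a p p') =
        ((primedMap V E φ a r r').comp (primedFraming V a q r)).comp
          (primedFraming V a p q)) ∧
    -- (iii) `t b = φ_{b, gVert a b}` is an isomorphism of representations and a
    -- framed `Ĥₙ`-invariant morphism `E → E'`: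
    (∀ (b b' : Vtx n) (j : Option (Fin n)), HasArrow b b' j →
      (φ b' (gVert a b')).comp (E b b') =
        (primedMap V E φ a b b').comp (φ b (gVert a b))) ∧
    (∀ b : Vtx n, Function.Bijective (φ b (gVert a b))) ∧
    (∀ b b' : Vtx n, lam b = lam b' →
      ((primedFraming V a b b').comp (φ b (gVert a b))).comp (φ b' b) =
        φ b' (gVert a b')) := by
  have hlg := lam_gVert a ha
  have hT : ∀ x y z : Vtx n, lam x = lam y → lam y = lam z → ∀ v, φ y z (φ x y v) = φ x z v := by
    intro x y z h1 h2 v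
    have h := hφ x x y z z none rfl rfl h1 h2
    rw [hEid, hEid] at h
    exact (LinearMap.congr_fun h v).symm
  have hI : ∀ x : Vtx n, ∀ v, φ x x v = v := by
    intro x v
    exact (hφbij x x rfl).1 (hT x x x rfl rfl v)
  have hid : ∀ x : Vtx n, φ x x = LinearMap.id := fun x => LinearMap.ext (hI x)
  have hC : ∀ (p p' r r' : Vtx n) (j : Option (Fin n)), HasArrow p p' j → HasArrow r r' j →
      lam p = lam r → ∀ v, φ p' r' (E p p' v) = E r r' (φ p r v) := by
    intro p p' r r' j h1 h2 h3 v
    have h := LinearMap.congr_fun (hφ p p' p r r' j h1 h2 rfl h3) v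
    simpa [hI] using h
  have hzero : ∀ b : Vtx n, n ≤ lam b → ∀ v : V (gVert a b), v = 0 := fun b hb =>
    hsupp _ (by rw [hlg]; exact hb)
  have hF : ∀ b c : Vtx n, lam b = lam c →
      primedFraming V a b c = φ (gVert a b) (gVert a c) := by
    intro b c h
    unfold primedFraming
    split_ifs with h'
    · rw [lcast_eq φ hid, hid]; rfl
    · by_cases hb : lam b < n
      · exfalso; apply h'
        unfold gVert
        rw [dif_pos hb, dif_pos (h ▸ hb)]
        congr 1
        exact Fin.ext h
      · ext v
        exact (hzero c (by omega) _).trans (hzero c (by omega) _).symm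
  have hP : ∀ (b b' : Vtx n) (j : Option (Fin n)), HasArrow b b' j → ∀ v,
      primedMap V E φ a b b' v = φ b' (gVert a b') (E b b' (φ (gVert a b) b v)) := by
    intro b b' j h v
    by_cases hb : n ≤ lam b'
    · exact (hzero b' hb _).trans (hzero b' hb _).symm
    unfold primedMap
    split_ifs with h1 h2
    · subst h1
      rw [lcast_eq φ hid, hid, hEid]
      simp [hT _ _ _ (hlg b) (hlg b).symm, hI]
    · have hb' : lam b' = lam b + 1 := lam_arrow h2.2.choose_spec
      have e1 : gVert a b = a ⟨lam b, by omega⟩ := dif_pos (by omega)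
      have e2 : gVert a b' = a ⟨lam b + 1, h2.1⟩ := by
        unfold gVert
        rw [dif_pos (by omega)]
        congr 1
        exact Fin.ext hb'
      simp only [lcast_eq φ hid, LinearMap.comp_apply]
      rw [hT b', hT (gVert a b)]
      · rw [hlg, ha]
      · rw [ha]
      · rw [ha, hb']
      · rw [hlg, ha, hb']
    · exfalso
      cases j with
      | none => exact h1 h
      | some j => exact h2 ⟨by have := lam_arrow h; omega, j, h⟩
  refine ⟨?_, ?_, ?_, hzero, ?_, ?_, ?_, ?_, ?_, ?_⟩
  · intro b
    ext v
    rw [hP b b none rfl, hEid]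
    simp [hT _ _ _ (hlg b) (hlg b).symm, hI]
  · intro p q r s j j' h1 h2 h3 h4
    ext v
    have h := LinearMap.congr_fun (hEcomm p q r s j j' h1 h2 h3 h4) (φ (gVert a p) p v)
    simp only [LinearMap.comp_apply] at h ⊢
    rw [hP q s j' h4, hP p q j h1, hP r s j h2, hP p r j' h3,
      hT _ _ _ (hlg q).symm (hlg q), hT _ _ _ (hlg r).symm (hlg r), hI, hI, h]
  · intro p q r s j h1 h2 h3 _ e1 e2
    have h4 := lam_hasArrow (j := some j) h1 h2 h3
    ext v
    rw [lcast_eq φ hid]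
    simp only [LinearMap.comp_apply]
    rw [hP p q (some j) h1, hP r s (some j) h2, hT q _ _ (hlg q).symm (by rw [e2]),
      hT _ _ p (by rw [e1]) (hlg p),
      ← hT q s _ h4 (hlg s).symm, hC p q r s (some j) h1 h2 h3,
      hT _ p r (by rw [hlg]; exact h3.symm) h3]
  · intro b c h
    unfold primedFraming
    rw [dif_pos h]
  · intro b c h
    rw [hF b c h]
    exact hφbij _ _ (by rw [hlg, hlg, h])
  · intro p p' q r r' j h1 h2 h3 h4
    have h5 := lam_hasArrow h1 h2 (h3.trans h4)
    ext v
    rw [hF _ _ h5, hF _ _ h3, hF _ _ h4]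
    simp only [LinearMap.comp_apply]
    rw [hP p p' j h1, hP r r' j h2, hT p' _ _ (hlg _).symm (by rw [hlg, hlg, h5]),
      ← hT p' r' _ h5 (hlg _).symm, hC p p' r r' j h1 h2 (h3.trans h4),
      hT _ p r (hlg _) (h3.trans h4),
      hT _ _ (gVert a r) (by rw [hlg, hlg, h3]) (by rw [hlg, hlg, h4]),
      hT _ _ r (by rw [hlg, hlg, h3, h4]) (hlg _)]
  · intro b b' j h
    ext v
    simp only [LinearMap.comp_apply]
    rw [hP b b' j h, hT _ _ _ (hlg b).symm (hlg b), hI]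
  · intro b
    exact hφbij _ _ (hlg b).symm
  · intro b b' h
    ext v
    rw [hF _ _ h]
    simp only [LinearMap.comp_apply]
    rw [hT _ _ _ h.symm (hlg b).symm, hT _ _ _ (by rw [hlg, h]) (by rw [hlg, hlg, h])]
end

section
/- Let E = (E_i, E^s_{i,i+1}) be a representation of the Beilinson quiver B_{n-1} with its commuting relations. Define F(E) on the quiver A_{n-1}^{⊗n} by F(E)_a := E_{λ(a)} for vertices a with λ(a) ≤ n-1 and F(E)_a := 0 otherwise, and, for each arrow a → b with λ(a) ≤ n-2, F(E)_{a,b} := E^{λ(a,b)}_{λ(a),λ(a)+1} (and the zero map otherwise). Then F(E) is a representation of A_{n-1}^{⊗n} satisfying the commuting relations, it is supported over vertices with indices 0,…,n-1, and together with the identity maps as framing isomorphisms (φ_{a,b} := id whenever λ(a) = λ(b) ≤ n-1) it is framed Ĥ_n-invariant; moreover, for any morphism f : E → E' of representations of B_{n-1}, the family F(f)_a := f_{λ(a)} is a framed Ĥ_n-invariant morphism F(E) → F(E'). -/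
/-- Transport of a linear map along equalities of levels. -/
def ncast {U U' : ℕ → Type}
    [∀ i, AddCommGroup (U i)] [∀ i, Module ℂ (U i)]
    [∀ i, AddCommGroup (U' i)] [∀ i, Module ℂ (U' i)]
    {i i' j j' : ℕ} (hi : i = i') (hj : j = j') (g : U i →ₗ[ℂ] U' j) :
    U i' →ₗ[ℂ] U' j' := by subst hi; subst hj; exact g

open Classical in
/-- The arrow maps of the representation `F(E)` of `A_{n-1}^{⊗ n}` induced by a
representation `B` of the Beilinson quiver `B_{n-1}` on spaces `U 0, …, U (n-1)`:
`F(E)_a = U (λ a)`, `F(E)_{a,b} = B^{λ(a,b)}_{λ(a),λ(a)+1}` on an arrow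
`a → b`, the identity on degenerate arrows, and the zero map otherwise. -/
noncomputable def Fmap (n : ℕ) (U : ℕ → Type)
    [∀ i, AddCommGroup (U i)] [∀ i, Module ℂ (U i)]
    (B : ∀ i : ℕ, Fin n → (U i →ₗ[ℂ] U (i + 1))) (a b : Vtx n) :
    U (lam a) →ₗ[ℂ] U (lam b) :=
  if hab : ∃ j : Fin n, IsArrow a b j then
    ncast rfl (lam_arrow hab.choose_spec).symm (B (lam a) hab.choose)
  else if h : a = b then ncast rfl (congrArg lam h) LinearMap.id
  else 0

/-- The identity framing isomorphisms on `F(E)`: the transport of the identity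
along `λ(a) = λ(b)` whenever the indices agree, and the zero map otherwise. -/
noncomputable def idFraming (n : ℕ) (U : ℕ → Type)
    [∀ i, AddCommGroup (U i)] [∀ i, Module ℂ (U i)]
    (a b : Vtx n) : U (lam a) →ₗ[ℂ] U (lam b) :=
  if h : lam a = lam b then ncast rfl h LinearMap.id else 0
lemma arrow_label_unique {n : ℕ} {a b : Vtx n} {j k : Fin n}
    (h : IsArrow a b j) (h' : IsArrow a b k) : j = k := by
  by_contra hne
  have h1 := h.1
  rw [h'.2 j hne] at h1
  omega

lemma Fmap_arrow (n : ℕ) (U : ℕ → Type)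
    [∀ i, AddCommGroup (U i)] [∀ i, Module ℂ (U i)]
    (B : ∀ i : ℕ, Fin n → (U i →ₗ[ℂ] U (i + 1))) (p q : Vtx n) (j : Fin n)
    (hj : IsArrow p q j) (h : lam p + 1 = lam q) :
    Fmap n U B p q = ncast rfl h (B (lam p) j) := by
  have hab : ∃ j : Fin n, IsArrow p q j := ⟨j, hj⟩
  unfold Fmap
  rw [dif_pos hab]
  have e : hab.choose = j := arrow_label_unique hab.choose_spec hj
  rw [e]

lemma Fmap_self (n : ℕ) (U : ℕ → Type)
    [∀ i, AddCommGroup (U i)] [∀ i, Module ℂ (U i)]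
    (B : ∀ i : ℕ, Fin n → (U i →ₗ[ℂ] U (i + 1))) (p : Vtx n) :
    Fmap n U B p p = LinearMap.id := by
  have hab : ¬ ∃ j : Fin n, IsArrow p p j := by
    rintro ⟨j, hj⟩
    have := hj.1
    omega
  unfold Fmap
  rw [dif_neg hab, dif_pos rfl]
  rfl

lemma idFraming_eq (n : ℕ) (U : ℕ → Type)
    [∀ i, AddCommGroup (U i)] [∀ i, Module ℂ (U i)]
    (a b : Vtx n) (h : lam a = lam b) :
    idFraming n U a b = ncast rfl h LinearMap.id := by
  unfold idFraming
  rw [dif_pos h]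

/-- Let `E = (U i, B i s)` be a representation of the Beilinson
quiver `B_{n-1}` with its commuting relations (modelled on an `ℕ`-indexed family
of finite-dimensional `ℂ`-vector spaces that vanishes above the vertices
`0, …, n-1` of `B_{n-1}`).  Then `F(E) := Fmap n U B` (with vertex spaces
`F(E)_a = U (λ a)`) is a representation of `A_{n-1}^{⊗ n}` satisfying the
commuting relations, it is supported over vertices with indices `0, …, n-1`,
and together with the identity framing isomorphisms `idFraming` it is framed
`Ĥₙ`-invariant.  Moreover, for any morphism `f : E → E'` of representations of
`B_{n-1}`, the family `F(f)_a := f (λ a)` is a framed `Ĥₙ`-invariant morphism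
`F(E) → F(E')`. -/
theorem stmt5 (n : ℕ) (hn : 2 ≤ n)
    (U U' : ℕ → Type)
    [∀ i, AddCommGroup (U i)] [∀ i, Module ℂ (U i)] [∀ i, FiniteDimensional ℂ (U i)]
    [∀ i, AddCommGroup (U' i)] [∀ i, Module ℂ (U' i)] [∀ i, FiniteDimensional ℂ (U' i)]
    -- the Beilinson quiver has only the vertices `0, …, n-1`; the spaces above
    -- them are zero:
    (hU : ∀ i : ℕ, n ≤ i → ∀ v : U i, v = 0)
    (hU' : ∀ i : ℕ, n ≤ i → ∀ v : U' i, v = 0)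
    (B : ∀ i : ℕ, Fin n → (U i →ₗ[ℂ] U (i + 1)))
    (B' : ∀ i : ℕ, Fin n → (U' i →ₗ[ℂ] U' (i + 1)))
    -- the commuting relations of the Beilinson quiver:
    (hB : ∀ i : ℕ, i + 1 ≤ n - 2 → ∀ s s' : Fin n,
      (B (i + 1) s).comp (B i s') = (B (i + 1) s').comp (B i s))
    (hB' : ∀ i : ℕ, i + 1 ≤ n - 2 → ∀ s s' : Fin n,
      (B' (i + 1) s).comp (B' i s') = (B' (i + 1) s').comp (B' i s))
    -- a morphism `f : E → E'` of representations of `B_{n-1}`: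
    (f : ∀ i : ℕ, U i →ₗ[ℂ] U' i)
    (hf : ∀ i : ℕ, i ≤ n - 2 → ∀ s : Fin n,
      (f (i + 1)).comp (B i s) = (B' i s).comp (f i)) :
    -- `F(E)` is a representation of `A_{n-1}^{⊗ n}`:
    (∀ a : Vtx n, Fmap n U B a a = LinearMap.id) ∧
    (∀ (p q r s : Vtx n) (j j' : Option (Fin n)),
      HasArrow p q j → HasArrow r s j → HasArrow p r j' → HasArrow q s j' →
      (Fmap n U B q s).comp (Fmap n U B p q) =
        (Fmap n U B r s).comp (Fmap n U B p r)) ∧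
    -- on an arrow `a → b` it is given by `B^{λ(a,b)}_{λ(a),λ(a)+1}`:
    (∀ (p q : Vtx n) (j : Fin n), IsArrow p q j → ∀ h : lam p + 1 = lam q,
      Fmap n U B p q = ncast rfl h (B (lam p) j)) ∧
    -- `F(E)` is supported over vertices with indices `0, …, n-1`:
    (∀ a : Vtx n, n ≤ lam a → ∀ v : U (lam a), v = 0) ∧
    -- the identity framings make `F(E)` framed `Ĥₙ`-invariant:
    (∀ a b : Vtx n, lam a = lam b → Function.Bijective (idFraming n U a b)) ∧
    (∀ (p p' q r r' : Vtx n) (j : Option (Fin n)),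
      HasArrow p p' j → HasArrow r r' j → lam p = lam q → lam q = lam r →
      (idFraming n U p' r').comp (Fmap n U B p p') =
        ((Fmap n U B r r').comp (idFraming n U q r)).comp (idFraming n U p q)) ∧
    -- `F(f)_a := f (λ a)` is a morphism of representations `F(E) → F(E')` …
    (∀ (p q : Vtx n) (j : Option (Fin n)), HasArrow p q j →
      (f (lam q)).comp (Fmap n U B p q) = (Fmap n U' B' p q).comp (f (lam p))) ∧
    -- … and it is framed `Ĥₙ`-invariant:
    (∀ b b' : Vtx n, lam b = lam b' →
      ((idFraming n U' b b').comp (f (lam b))).comp (idFraming n U b' b) =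
        f (lam b')) := by
  refine ⟨Fmap_self n U B, ?_, Fmap_arrow n U B, fun a h v => hU _ h v, ?_, ?_, ?_, ?_⟩
  · intro p q r s j j' hpq hrs hpr hqs
    cases j with
    | none =>
      obtain rfl : p = q := hpq
      obtain rfl : r = s := hrs
      rw [Fmap_self, Fmap_self, LinearMap.comp_id, LinearMap.id_comp]
    | some j =>
      cases j' with
      | none =>
        obtain rfl : p = r := hpr
        obtain rfl : q = s := hqs
        rw [Fmap_self, Fmap_self, LinearMap.comp_id, LinearMap.id_comp]
      | some j' =>
        have h1 := lam_arrow hpq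
        have h2 := lam_arrow hrs
        have h3 := lam_arrow hpr
        have h4 := lam_arrow hqs
        rw [Fmap_arrow n U B p q j hpq h1.symm, Fmap_arrow n U B r s j hrs h2.symm,
          Fmap_arrow n U B p r j' hpr h3.symm, Fmap_arrow n U B q s j' hqs h4.symm]
        generalize lam s = ls at *
        generalize lam q = lq at *
        generalize lam r = lr at *
        generalize lam p = lp at *
        subst h1
        subst h3
        subst h4
        show (B (lp + 1) j').comp (B lp j) = (B (lp + 1) j).comp (B lp j')
        by_cases hl : lp + 1 ≤ n - 2
        · exact hB lp hl j' j
        · ext v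
          rw [hU (lp + 1 + 1) (by omega) (((B (lp + 1) j').comp (B lp j)) v),
            hU (lp + 1 + 1) (by omega) (((B (lp + 1) j).comp (B lp j')) v)]
  · intro a b h
    rw [idFraming_eq n U a b h]
    generalize lam b = lb at *
    subst h
    exact Function.bijective_id
  · intro p p' q r r' j hp hr h1 h2
    cases j with
    | none =>
      obtain rfl : p = p' := hp
      obtain rfl : r = r' := hr
      rw [Fmap_self, Fmap_self, LinearMap.comp_id, LinearMap.id_comp,
        idFraming_eq n U p q h1, idFraming_eq n U q r h2, idFraming_eq n U p r (h1.trans h2)]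
      generalize lam r = lr at *
      generalize lam q = lq at *
      subst h1
      subst h2
      rfl
    | some j =>
      have h3 := lam_arrow hp
      have h4 := lam_arrow hr
      have h5 : lam p' = lam r' := by omega
      rw [Fmap_arrow n U B p p' j hp h3.symm, Fmap_arrow n U B r r' j hr h4.symm,
        idFraming_eq n U p q h1, idFraming_eq n U q r h2, idFraming_eq n U p' r' h5]
      generalize lam r' = lr' at *
      generalize lam p' = lp' at *
      generalize lam r = lr at *
      generalize lam q = lq at *
      subst h1
      subst h2
      subst h3
      subst h5
      rfl
  · intro p q j hpq
    cases j with
    | none =>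
      obtain rfl : p = q := hpq
      rw [Fmap_self, Fmap_self, LinearMap.comp_id, LinearMap.id_comp]
    | some j =>
      have h1 := lam_arrow hpq
      rw [Fmap_arrow n U B p q j hpq h1.symm, Fmap_arrow n U' B' p q j hpq h1.symm]
      generalize lam q = lq at *
      generalize lam p = lp at *
      subst h1
      show (f (lp + 1)).comp (B lp j) = (B' lp j).comp (f lp)
      by_cases hl : lp ≤ n - 2
      · exact hf lp hl j
      · ext v
        rw [hU' (lp + 1) (by omega) (((f (lp + 1)).comp (B lp j)) v),
          hU' (lp + 1) (by omega) (((B' lp j).comp (f lp)) v)]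
  · intro b b' h
    rw [idFraming_eq n U' b b' h, idFraming_eq n U b' b h.symm]
    generalize lam b' = lb' at *
    subst h
    rfl
end

section
/- The category fmod A_{n-1}^{⊗n,≤n-1}, whose objects are framed Ĥ_n-invariant representations of A_{n-1}^{⊗n} (each equipped with its framing isomorphisms) supported over vertices with indices 0,…,n-1 and whose morphisms are the framed Ĥ_n-invariant morphisms, is equivalent to the category of representations of the Beilinson quiver B_{n-1} with its commuting relations. -/
/-- An object of the category `fmod A_{n-1}^{⊗ n, ≤ n-1}`: a framed
`Ĥₙ`-invariant representation of `A_{n-1}^{⊗ n}` (with the commuting relations,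
on finite-dimensional `ℂ`-vector spaces), equipped with its framing
isomorphisms, and supported over vertices with indices `0, …, n-1`. -/
structure FRep (n : ℕ) where
  V : Vtx n → Type
  [acg : ∀ a, AddCommGroup (V a)]
  [mod : ∀ a, Module ℂ (V a)]
  [fd : ∀ a, FiniteDimensional ℂ (V a)]
  map : ∀ a b : Vtx n, V a →ₗ[ℂ] V b
  φ : ∀ a b : Vtx n, V a →ₗ[ℂ] V b
  map_id : ∀ a, map a a = LinearMap.id
  comm : ∀ (p q r s : Vtx n) (j j' : Option (Fin n)),
    HasArrow p q j → HasArrow r s j → HasArrow p r j' → HasArrow q s j' →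
    (map q s).comp (map p q) = (map r s).comp (map p r)
  framing_bij : ∀ a b, lam a = lam b → Function.Bijective (φ a b)
  framing_compat : ∀ (a a' b c c' : Vtx n) (j : Option (Fin n)),
    HasArrow a a' j → HasArrow c c' j → lam a = lam b → lam b = lam c →
    (φ a' c').comp (map a a') = ((map c c').comp (φ b c)).comp (φ a b)
  supp : ∀ b, n ≤ lam b → ∀ v : V b, v = 0

attribute [instance] FRep.acg FRep.mod FRep.fd

/-- A framed `Ĥₙ`-invariant morphism of framed representations. -/
@[ext]
structure FHom {n : ℕ} (X Y : FRep n) where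
  f : ∀ a, X.V a →ₗ[ℂ] Y.V a
  comm : ∀ (a b : Vtx n) (j : Option (Fin n)), HasArrow a b j →
    (f b).comp (X.map a b) = (Y.map a b).comp (f a)
  framed : ∀ b b' : Vtx n, lam b = lam b' →
    ((Y.φ b b').comp (f b)).comp (X.φ b' b) = f b'
namespace FRep

lemma cocycle {n : ℕ} (X : FRep n) (x y z : Vtx n)
    (hxy : lam x = lam y) (hyz : lam y = lam z) :
    (X.φ y z).comp (X.φ x y) = X.φ x z := by
  have h := X.framing_compat x x y z z none rfl rfl hxy hyz
  rw [X.map_id, X.map_id] at h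
  simpa using h.symm

lemma phi_self {n : ℕ} (X : FRep n) (x : Vtx n) : X.φ x x = LinearMap.id := by
  have h := X.cocycle x x x rfl rfl
  ext v
  exact (X.framing_bij x x rfl).injective (by simpa using LinearMap.congr_fun h v)

lemma phi_inv {n : ℕ} (X : FRep n) {x y : Vtx n} (h : lam x = lam y) :
    (X.φ y x).comp (X.φ x y) = LinearMap.id := by
  rw [X.cocycle x y x h h.symm, X.phi_self]

lemma phi_inv_apply {n : ℕ} (X : FRep n) {x y : Vtx n} (h : lam x = lam y)
    (v : X.V x) : X.φ y x (X.φ x y v) = v := by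
  simpa using LinearMap.congr_fun (X.phi_inv h) v

end FRep

noncomputable instance FRep.category (n : ℕ) : CategoryTheory.Category (FRep n) where
  Hom X Y := FHom X Y
  id X :=
    { f := fun _ => LinearMap.id
      comm := by intro a b j hj; simp
      framed := by
        intro b b' h
        simpa using X.cocycle b' b b' h.symm h ▸ X.phi_self b' }
  comp {X Y Z} F G :=
    { f := fun a => (G.f a).comp (F.f a)
      comm := by
        intro a b j hj
        rw [LinearMap.comp_assoc, F.comm a b j hj, ← LinearMap.comp_assoc,
          G.comm a b j hj, LinearMap.comp_assoc]
      framed := by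
        intro b b' h
        ext v
        have h1 : Y.φ b b' (F.f b (X.φ b' b v)) = F.f b' v :=
          LinearMap.congr_fun (F.framed b b' h) v
        have h2 : Z.φ b b' (G.f b (Y.φ b' b (F.f b' v))) = G.f b' (F.f b' v) :=
          LinearMap.congr_fun (G.framed b b' h) (F.f b' v)
        simp only [LinearMap.coe_comp, Function.comp_apply]
        rw [← h2, ← h1, Y.phi_inv_apply h] }
  id_comp F := by apply FHom.ext; funext a; exact LinearMap.comp_id _
  comp_id F := by apply FHom.ext; funext a; exact LinearMap.id_comp _
  assoc F G H := by apply FHom.ext; funext a; exact (LinearMap.comp_assoc _ _ _).symm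
/-- A representation of the Beilinson quiver `B_{n-1}` with its commuting
relations: finite-dimensional `ℂ`-vector spaces `V 0, …, V (n-1)` and, for each
`i` with `i + 1 ≤ n - 1` and each label `s ∈ {1, …, n}`, linear maps
`map i s : V i → V (i+1)` such that consecutive maps commute. -/
structure BRep (n : ℕ) where
  V : Fin n → Type
  [acg : ∀ i, AddCommGroup (V i)]
  [mod : ∀ i, Module ℂ (V i)]
  [fd : ∀ i, FiniteDimensional ℂ (V i)]
  map : ∀ (i : ℕ) (hi : i + 1 < n) (s : Fin n),
    V ⟨i, Nat.lt_of_succ_lt hi⟩ →ₗ[ℂ] V ⟨i + 1, hi⟩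
  comm : ∀ (i : ℕ) (hi : i + 2 < n) (s s' : Fin n),
    (map (i + 1) hi s).comp (map i (Nat.lt_of_succ_lt hi) s') =
      (map (i + 1) hi s').comp (map i (Nat.lt_of_succ_lt hi) s)

attribute [instance] BRep.acg BRep.mod BRep.fd

/-- A morphism of representations of the Beilinson quiver `B_{n-1}`. -/
@[ext]
structure BHom {n : ℕ} (X Y : BRep n) where
  f : ∀ i, X.V i →ₗ[ℂ] Y.V i
  comm : ∀ (i : ℕ) (hi : i + 1 < n) (s : Fin n),
    (f ⟨i + 1, hi⟩).comp (X.map i hi s) =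
      (Y.map i hi s).comp (f ⟨i, Nat.lt_of_succ_lt hi⟩)

noncomputable instance BRep.category (n : ℕ) : CategoryTheory.Category (BRep n) where
  Hom X Y := BHom X Y
  id X :=
    { f := fun _ => LinearMap.id
      comm := by intro i hi s; simp }
  comp {X Y Z} F G :=
    { f := fun i => (G.f i).comp (F.f i)
      comm := by
        intro i hi s
        rw [LinearMap.comp_assoc, F.comm i hi s, ← LinearMap.comp_assoc,
          G.comm i hi s, LinearMap.comp_assoc] }
  id_comp F := by apply BHom.ext; funext i; exact LinearMap.comp_id _
  comp_id F := by apply BHom.ext; funext i; exact LinearMap.id_comp _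
  assoc F G H := by apply BHom.ext; funext i; exact (LinearMap.comp_assoc _ _ _).symm

open CategoryTheory

namespace Stmt6

variable {n : ℕ}

lemma lam_arrow {a b : Vtx n} {s : Fin n} (h : IsArrow a b s) : lam b = lam a + 1 := by
  unfold lam
  rw [← Finset.add_sum_erase _ _ (Finset.mem_univ s), h.1,
    ← Finset.add_sum_erase (f := fun i => ((a i : Fin n) : ℕ)) _ (Finset.mem_univ s)]
  rw [Finset.sum_congr rfl (g := fun i => ((a i : Fin n) : ℕ))]
  · ring
  · intro x hx
    rw [h.2 x (Finset.ne_of_mem_erase hx)]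

def deg : Option (Fin n) → ℕ
  | none => 0
  | some _ => 1

lemma lam_has {a b : Vtx n} {j : Option (Fin n)} (h : HasArrow a b j) :
    lam b = lam a + deg j := by
  cases j with
  | none => cases h; rfl
  | some s => exact lam_arrow h

lemma has_unique {a b : Vtx n} {j j' : Option (Fin n)} (h : HasArrow a b j)
    (h' : HasArrow a b j') : j = j' := by
  have h1 := lam_has h
  have h2 := lam_has h'
  cases j with
  | none =>
    cases j' with
    | none => rfl
    | some s => simp [deg] at h1 h2; omega
  | some s =>
    cases j' with
    | none => simp [deg] at h1 h2; omega
    | some s' =>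
      by_contra hne
      have hne' : s ≠ s' := fun e => hne (by rw [e])
      have e1 := h.1
      have e2 := h'.2 s hne'
      rw [e2] at e1
      omega

def base (i : Fin n) : Vtx n := fun k => if k.val = 0 then i else ⟨0, i.pos⟩

lemma lam_base (i : Fin n) : lam (base i) = i := by
  unfold lam base
  rw [Finset.sum_eq_single ⟨0, i.pos⟩]
  · simp
  · intro b _ hb
    have : b.val ≠ 0 := fun h => hb (Fin.ext h)
    simp [this]
  · simp

def up (a : Vtx n) (s : Fin n) (h : (a s : ℕ) + 1 < n) : Vtx n :=
  Function.update a s ⟨a s + 1, h⟩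

lemma up_arrow (a : Vtx n) (s : Fin n) (h : (a s : ℕ) + 1 < n) : IsArrow a (up a s h) s := by
  constructor
  · simp [up]
  · intro i hi
    simp [up, hi]

lemma base_le (i : Fin n) (k : Fin n) : ((base i k : Fin n) : ℕ) ≤ i := by
  unfold base; split_ifs <;> simp

abbrev bup (i : ℕ) (hi : i + 1 < n) (s : Fin n) : Vtx n :=
  up (base ⟨i, Nat.lt_of_succ_lt hi⟩) s
    (lt_of_le_of_lt (Nat.succ_le_succ (base_le _ s)) hi)

lemma lam_bup (i : ℕ) (hi : i + 1 < n) (s : Fin n) : lam (bup i hi s) = i + 1 := by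
  rw [lam_arrow (up_arrow _ s _), lam_base]

lemma bup_arrow (i : ℕ) (hi : i + 1 < n) (s : Fin n) :
    IsArrow (base ⟨i, Nat.lt_of_succ_lt hi⟩) (bup i hi s) s := up_arrow _ _ _

lemma square (i : ℕ) (hi : i + 2 < n) (s s' : Fin n) (hs : s ≠ s') :
    ∃ q : Vtx n, IsArrow (bup i (Nat.lt_of_succ_lt hi) s) q s' ∧
      IsArrow (bup i (Nat.lt_of_succ_lt hi) s') q s := by
  have hb : ((bup i (Nat.lt_of_succ_lt hi) s s' : Fin n) : ℕ)
      = (base ⟨i, by omega⟩ s' : Fin n) := by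
    rw [(bup_arrow i (Nat.lt_of_succ_lt hi) s).2 s' hs.symm]
  have hle := base_le (⟨i, by omega⟩ : Fin n) s'
  simp only at hle
  refine ⟨up (bup i (Nat.lt_of_succ_lt hi) s) s' (by omega), up_arrow _ _ _, ?_, ?_⟩
  · simp [bup, up, hs, hs.symm]
  · intro k hk
    by_cases hk' : k = s'
    · subst hk'; simp [bup, up, hs, hs.symm]
    · simp [bup, up, hk, hk']

/-! ### The functor to Beilinson representations -/

lemma phi_comp (X : FRep n) {x y z : Vtx n} (hxy : lam x = lam y) (hyz : lam y = lam z)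
    (v : X.V x) : X.φ y z (X.φ x y v) = X.φ x z v :=
  LinearMap.congr_fun (X.cocycle x y z hxy hyz) v

lemma compat (X : FRep n) {a a' c c' : Vtx n} {j : Option (Fin n)} (h : HasArrow a a' j)
    (h' : HasArrow c c' j) (hl : lam a = lam c) (v : X.V a) :
    X.φ a' c' (X.map a a' v) = X.map c c' (X.φ a c v) := by
  have := LinearMap.congr_fun (X.framing_compat a a' a c c' j h h' rfl hl) v
  simpa [X.phi_self] using this

def gmap (X : FRep n) (i : ℕ) (hi : i + 1 < n) (s : Fin n) :
    X.V (base ⟨i, Nat.lt_of_succ_lt hi⟩) →ₗ[ℂ] X.V (base ⟨i + 1, hi⟩) :=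
  (X.φ (bup i hi s) (base ⟨i + 1, hi⟩)).comp (X.map _ (bup i hi s))

lemma gmap_phi (X : FRep n) (i : ℕ) (hi : i + 1 < n) (s : Fin n) {a b : Vtx n}
    (h : IsArrow a b s) (ha : lam a = i) (v : X.V a) :
    gmap X i hi s (X.φ a (base ⟨i, Nat.lt_of_succ_lt hi⟩) v) =
      X.φ b (base ⟨i + 1, hi⟩) (X.map a b v) := by
  have hb := lam_arrow h
  have h1 := compat X (j := some s) h (bup_arrow i hi s) (by rw [lam_base, ha]) v
  unfold gmap
  rw [LinearMap.comp_apply, ← h1]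
  exact phi_comp X (by rw [lam_bup]; omega) (by rw [lam_bup, lam_base]) _

lemma gmap_phi' (X : FRep n) (i : ℕ) (hi : i + 1 < n) (s : Fin n) {a b : Vtx n}
    (h : IsArrow a b s) (ha : lam a = i) (v : X.V (base ⟨i, Nat.lt_of_succ_lt hi⟩)) :
    X.φ (base ⟨i + 1, hi⟩) b (gmap X i hi s v) =
      X.map a b (X.φ (base ⟨i, Nat.lt_of_succ_lt hi⟩) a v) := by
  have hb := lam_arrow h
  have h1 := compat X (j := some s) (bup_arrow i hi s) h (by rw [lam_base, ha]) v
  unfold gmap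
  rw [LinearMap.comp_apply, ← h1]
  exact phi_comp X (by rw [lam_bup, lam_base]) (by rw [lam_base]; simp; omega) _

def G (X : FRep n) : BRep n where
  V i := X.V (base i)
  map i hi s := gmap X i hi s
  comm i hi s s' := by
    by_cases hs : s = s'
    · rw [hs]
    obtain ⟨q, h1, h2⟩ := square i hi s s' hs
    ext v
    have e1 := gmap_phi X (i+1) hi s' h1 (lam_bup _ _ _) (X.map _ _ v)
    have e2 := gmap_phi X (i+1) hi s h2 (lam_bup _ _ _) (X.map _ _ v)
    have e3 := LinearMap.congr_fun (X.comm _ _ _ q (some s) (some s')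
      (bup_arrow i (Nat.lt_of_succ_lt hi) s) h2
      (bup_arrow i (Nat.lt_of_succ_lt hi) s') h1) v
    simp only [LinearMap.comp_apply] at e3 ⊢
    rw [e3] at e1
    exact e2.trans e1.symm

lemma fhom_phi {X Y : FRep n} (F : FHom X Y) {b b' : Vtx n} (h : lam b = lam b') (v : X.V b') :
    Y.φ b b' (F.f b (X.φ b' b v)) = F.f b' v :=
  LinearMap.congr_fun (F.framed b b' h) v

lemma gmap_hom {X Y : FRep n} (F : FHom X Y) (i : ℕ) (hi : i + 1 < n) (s : Fin n)
    (v : X.V (base ⟨i, Nat.lt_of_succ_lt hi⟩)) :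
    F.f (base ⟨i+1, hi⟩) (gmap X i hi s v) = gmap Y i hi s (F.f _ v) := by
  have h1 := LinearMap.congr_fun (FHom.comm F _ _ (some s) (bup_arrow i hi s)) v
  have h2 := fhom_phi F (b := bup i hi s) (b' := base ⟨i+1, hi⟩)
    (by rw [lam_base, lam_bup]) (gmap X i hi s v)
  rw [← h2]
  unfold gmap
  simp only [LinearMap.comp_apply] at h1 ⊢
  rw [X.phi_inv_apply (by rw [lam_base, lam_bup]), h1]

def GF (n : ℕ) : FRep n ⥤ BRep n where
  obj X := G X
  map {X Y} F :=
    { f := fun i => FHom.f F (base i)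
      comm := fun i hi s => LinearMap.ext fun v => gmap_hom F i hi s v }
  map_id X := rfl
  map_comp F G := rfl

lemma bhom_comm {X Y : BRep n} (F : BHom X Y) (i : ℕ) (hi : i + 1 < n) (s : Fin n) (v) :
    F.f ⟨i+1, hi⟩ (X.map i hi s v) = Y.map i hi s (F.f ⟨i, Nat.lt_of_succ_lt hi⟩ v) :=
  LinearMap.congr_fun (F.comm i hi s) v

instance : (GF n).Faithful where
  map_injective {X Y} F F' h := by
    apply FHom.ext
    funext a
    ext v
    by_cases ha : lam a < n
    · have hb : lam (base ⟨lam a, ha⟩) = lam a := lam_base _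
      have e : FHom.f F (base ⟨lam a, ha⟩) = FHom.f F' (base ⟨lam a, ha⟩) :=
        congrFun (congrArg BHom.f h) ⟨lam a, ha⟩
      rw [← fhom_phi F hb, ← fhom_phi F' hb, e]
    · rw [Y.supp a (by omega) (FHom.f F a v), Y.supp a (by omega) (FHom.f F' a v)]

open Classical in
noncomputable def lift {X Y : FRep n} (g : BHom (G X) (G Y)) (a : Vtx n) : X.V a →ₗ[ℂ] Y.V a :=
  if h : lam a < n then
    (Y.φ (base ⟨lam a, h⟩) a).comp ((g.f ⟨lam a, h⟩).comp (X.φ a (base ⟨lam a, h⟩)))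
  else 0

lemma lift_apply {X Y : FRep n} (g : BHom (G X) (G Y)) (a : Vtx n) (i : ℕ) (hi : i < n)
    (h : lam a = i) (v : X.V a) :
    lift g a v = Y.φ (base ⟨i, hi⟩) a (g.f ⟨i, hi⟩ (X.φ a (base ⟨i, hi⟩) v)) := by
  subst h
  simp only [lift, hi, dite_true]
  rfl

noncomputable def liftHom {X Y : FRep n} (g : BHom (G X) (G Y)) : FHom X Y where
  f := lift g
  comm := by
    intro a b j hj
    ext v
    cases j with
    | none =>
      cases hj
      simp [X.map_id, Y.map_id]
    | some s =>
      have hb := lam_arrow hj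
      by_cases h : lam a + 1 < n
      · simp only [LinearMap.comp_apply]
        rw [lift_apply g b _ h hb, lift_apply g a _ (Nat.lt_of_succ_lt h) rfl,
          ← gmap_phi X _ h s hj rfl]
        have := bhom_comm g (lam a) h s (X.φ a (base ⟨lam a, Nat.lt_of_succ_lt h⟩) v)
        refine (congrArg _ this).trans ?_
        exact gmap_phi' Y _ h s hj rfl _
      · rw [Y.supp b (by omega) (((lift g b).comp (X.map a b)) v), eq_comm]
        exact Y.supp b (by omega) _
  framed := by
    intro b b' h
    ext v
    by_cases hb : lam b < n
    · simp only [LinearMap.comp_apply]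
      rw [lift_apply g b _ hb rfl, lift_apply g b' _ hb h.symm,
        phi_comp X h.symm (by rw [lam_base])]
      exact phi_comp Y (by rw [lam_base]) h _
    · exact (Y.supp b' (by omega) _).trans (Y.supp b' (by omega) _).symm

lemma lift_base {X Y : FRep n} (g : BHom (G X) (G Y)) (i : Fin n) : lift g (base i) = g.f i := by
  apply LinearMap.ext
  intro v
  refine (lift_apply g (base i) i i.isLt (lam_base i) v).trans ?_
  rw [X.phi_self, Y.phi_self]
  rfl

instance : (GF n).Full where
  map_surjective {X Y} g := ⟨liftHom g, BHom.ext (funext fun i => lift_base g i)⟩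

/-! ### Essential surjectivity -/

def E (W : BRep n) (i : ℕ) : Type := ∀ h : PLift (i < n), W.V ⟨i, h.down⟩

instance (W : BRep n) (i : ℕ) : AddCommGroup (E W i) :=
  inferInstanceAs (AddCommGroup (∀ h : PLift (i < n), W.V ⟨i, h.down⟩))
instance (W : BRep n) (i : ℕ) : Module ℂ (E W i) :=
  inferInstanceAs (Module ℂ (∀ h : PLift (i < n), W.V ⟨i, h.down⟩))
instance (W : BRep n) (i : ℕ) : FiniteDimensional ℂ (E W i) :=
  inferInstanceAs (Module.Finite ℂ (∀ h : PLift (i < n), W.V ⟨i, h.down⟩))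

def tr (W : BRep n) (i j : ℕ) : E W i →ₗ[ℂ] E W j :=
  if h : i = j then h ▸ LinearMap.id else 0

lemma tr_self (W : BRep n) (i : ℕ) : tr W i i = LinearMap.id := by simp [tr]

def M (W : BRep n) (i : ℕ) (s : Fin n) : E W i →ₗ[ℂ] E W (i + 1) where
  toFun v := fun h => W.map i h.down s (v ⟨Nat.lt_of_succ_lt h.down⟩)
  map_add' u v := by funext h; exact map_add (W.map i h.down s) _ _
  map_smul' c v := by funext h; exact map_smul (W.map i h.down s) _ _

lemma M_comm (W : BRep n) (i : ℕ) (s s' : Fin n) :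
    (M W (i + 1) s).comp (M W i s') = (M W (i + 1) s').comp (M W i s) := by
  ext v
  funext h
  exact LinearMap.congr_fun (W.comm i h.down s s') (v _)

def stp (W : BRep n) (i k : ℕ) : Option (Fin n) → (E W i →ₗ[ℂ] E W k)
  | none => tr W i k
  | some s => (tr W (i + 1) k).comp (M W i s)

open Classical in
noncomputable def fmap (W : BRep n) (a b : Vtx n) : E W (lam a) →ₗ[ℂ] E W (lam b) :=
  if h : ∃ j, HasArrow a b j then stp W (lam a) (lam b) h.choose else 0

lemma fmap_eq (W : BRep n) {a b : Vtx n} {j : Option (Fin n)} (h : HasArrow a b j) :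
    fmap W a b = stp W (lam a) (lam b) j := by
  have h' : ∃ j, HasArrow a b j := ⟨j, h⟩
  simp only [fmap, h', dite_true]
  rw [has_unique h'.choose_spec h]

lemma stp_comm (W : BRep n) (p q r s : ℕ) (j j' : Option (Fin n)) (h1 : q = p + deg j)
    (h2 : s = r + deg j) (h3 : r = p + deg j') :
    (stp W q s j').comp (stp W p q j) = (stp W r s j).comp (stp W p r j') := by
  subst h1 h2 h3
  cases j <;> cases j' <;> simp [stp, deg, tr_self]
  · rfl
  · rfl
  · rfl
  · exact M_comm W p _ _

lemma stp_tr (W : BRep n) (a a' c c' : ℕ) (j : Option (Fin n)) (h1 : a' = a + deg j)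
    (h2 : c' = c + deg j) (h3 : a = c) :
    (tr W a' c').comp (stp W a a' j) = (stp W c c' j).comp (tr W a c) := by
  subst h1 h2 h3
  simp [tr_self]

lemma tr_tr (W : BRep n) (a b c : ℕ) (h : a = b) (h' : b = c) :
    (tr W b c).comp (tr W a b) = tr W a c := by
  subst h h'
  simp [tr_self]

noncomputable def FR (W : BRep n) : FRep n where
  V a := E W (lam a)
  map a b := fmap W a b
  φ a b := tr W (lam a) (lam b)
  map_id a := by
    rw [fmap_eq W (j := none) rfl]
    exact tr_self _ _
  comm p q r s j j' h1 h2 h3 h4 := by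
    rw [fmap_eq W h1, fmap_eq W h2, fmap_eq W h3, fmap_eq W h4]
    exact stp_comm W _ _ _ _ _ _ (lam_has h1) (lam_has h2) (lam_has h3)
  framing_bij a b h := by
    rw [h, tr_self]
    exact Function.bijective_id
  framing_compat a a' b c c' j h1 h2 h3 h4 := by
    rw [fmap_eq W h1, fmap_eq W h2, LinearMap.comp_assoc, tr_tr W _ _ _ h3 h4]
    exact stp_tr W _ _ _ _ _ (lam_has h1) (lam_has h2) (h3.trans h4)
  supp b hb v := by
    funext h
    have := h.down
    omega

def ev (W : BRep n) (i : Fin n) : E W i →ₗ[ℂ] W.V i where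
  toFun v := v ⟨i.isLt⟩
  map_add' _ _ := rfl
  map_smul' _ _ := rfl

def cst (W : BRep n) (i : Fin n) : W.V i →ₗ[ℂ] E W i where
  toFun w := fun _ => w
  map_add' _ _ := rfl
  map_smul' _ _ := rfl

def toHom (W : BRep n) (i : Fin n) : E W (lam (base i)) →ₗ[ℂ] W.V i :=
  (ev W i).comp (tr W _ _)

def ofHom (W : BRep n) (i : Fin n) : W.V i →ₗ[ℂ] E W (lam (base i)) :=
  (tr W _ _).comp (cst W i)

lemma to_of (W : BRep n) (i : Fin n) : (toHom W i).comp (ofHom W i) = LinearMap.id := by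
  ext v
  have := LinearMap.congr_fun (tr_tr W i (lam (base i)) i (lam_base i).symm (lam_base i))
    (cst W i v)
  simp only [LinearMap.comp_apply, tr_self] at this
  simp only [toHom, ofHom, LinearMap.comp_apply]
  rw [this]
  rfl

lemma of_to (W : BRep n) (i : Fin n) : (ofHom W i).comp (toHom W i) = LinearMap.id := by
  have h : (cst W i).comp (ev W i) = LinearMap.id := rfl
  unfold toHom ofHom
  rw [LinearMap.comp_assoc, ← LinearMap.comp_assoc (tr W _ _) (ev W i), h, LinearMap.id_comp,
    tr_tr W _ _ _ (lam_base i) (lam_base i).symm, tr_self]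

lemma aux (W : BRep n) (i a b c : ℕ) (s : Fin n) (ha : a = i) (hb : b = a + 1) (hc : c = i + 1) :
    (tr W c (i+1)).comp ((tr W b c).comp (stp W a b (some s))) = (M W i s).comp (tr W a i) := by
  subst ha hb hc
  simp [tr_self, stp]

noncomputable def gmapE (W : BRep n) (i : ℕ) (hi : i + 1 < n) (s : Fin n) :
    E W (lam (base ⟨i, Nat.lt_of_succ_lt hi⟩)) →ₗ[ℂ] E W (lam (base ⟨i + 1, hi⟩)) :=
  gmap (FR W) i hi s

lemma toHom_comm (W : BRep n) (i : ℕ) (hi : i + 1 < n) (s : Fin n) :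
    (toHom W ⟨i + 1, hi⟩).comp (gmapE W i hi s) =
      (W.map i hi s).comp (toHom W ⟨i, Nat.lt_of_succ_lt hi⟩) := by
  have e : gmapE W i hi s = (tr W (lam (bup i hi s)) _).comp
      (stp W _ (lam (bup i hi s)) (some s)) := by
    rw [← fmap_eq W (show HasArrow (base ⟨i, Nat.lt_of_succ_lt hi⟩) (bup i hi s) (some s) from
      bup_arrow i hi s)]
    rfl
  rw [e]
  have := aux W i (lam (base ⟨i, Nat.lt_of_succ_lt hi⟩)) (lam (bup i hi s))
    (lam (base ⟨i + 1, hi⟩)) s (lam_base _) (lam_arrow (bup_arrow i hi s)) (lam_base _)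
  unfold toHom
  refine (congrArg (fun z => (ev W ⟨i + 1, hi⟩).comp z) this).trans ?_
  rfl

lemma ofHom_comm (W : BRep n) (i : ℕ) (hi : i + 1 < n) (s : Fin n) :
    (ofHom W ⟨i + 1, hi⟩).comp (W.map i hi s) =
      (gmapE W i hi s).comp (ofHom W ⟨i, Nat.lt_of_succ_lt hi⟩) := by
  ext v
  have h := LinearMap.congr_fun (toHom_comm W i hi s) (ofHom W ⟨i, Nat.lt_of_succ_lt hi⟩ v)
  have h1 := LinearMap.congr_fun (to_of W ⟨i, Nat.lt_of_succ_lt hi⟩) v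
  simp only [LinearMap.comp_apply, LinearMap.id_apply] at h h1 ⊢
  rw [h1] at h
  rw [← h]
  exact LinearMap.congr_fun (of_to W ⟨i + 1, hi⟩) _

noncomputable def isoW (W : BRep n) : (GF n).obj (FR W) ≅ W where
  hom := (BHom.mk (fun i => toHom W i) (toHom_comm W) : BHom (G (FR W)) W)
  inv := (BHom.mk (fun i => ofHom W i) (ofHom_comm W) : BHom W (G (FR W)))
  hom_inv_id := by
    apply BHom.ext
    funext i
    exact of_to W i
  inv_hom_id := by
    apply BHom.ext
    funext i
    exact to_of W i

instance : (GF n).EssSurj where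
  mem_essImage W := ⟨FR W, ⟨isoW W⟩⟩

instance : (GF n).IsEquivalence where

end Stmt6

/-- Proposition `prop:eq`.  For `n ≥ 3`, the category
`fmod A_{n-1}^{⊗ n, ≤ n-1}` of framed `Ĥₙ`-invariant representations of
`A_{n-1}^{⊗ n}` supported over vertices with indices `0, …, n-1` (with framed
`Ĥₙ`-invariant morphisms) is equivalent to the category of representations of
the Beilinson quiver `B_{n-1}` with its commuting relations. -/
theorem stmt6 (n : ℕ) (hn : 3 ≤ n) :
    Nonempty (CategoryTheory.Equivalence (FRep n) (BRep n)) := by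
  exact ⟨(Stmt6.GF n).asEquivalence⟩
end
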